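/- arXiv:2208.04731 — 10 statements merged into one kernel-verified Lean document; each statement's English description precedes it below -/
import Mathlib

section
/- Let P and Q be probability mass functions on binary strings of length n. Suppose (a) P and Q have equal single-coordinate marginals, i.e. for every coordinate j and every string x, P(x with coordinate j set to 0) + P(x with coordinate j set to 1) = Q(x with coordinate j set to 0) + Q(x with coordinate j set to 1); and (b) P and Q assign equal probability to the event that the total parity ∑_{i} x i equals 0. Then P = Q. (This is the induction step in the proof that parity-check probabilities determine a pmf.) -/
/-- A function of a vector that is unchanged by updating any one coordinate is constant. -/
theorem eq_of_update_eq {ι α β : Type*} [Fintype ι] [DecidableEq ι] {g : (ι → α) → β}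
    (h : ∀ x j b, g (Function.update x j b) = g x) (x y : ι → α) : g x = g y := by
  have key : ∀ s : Finset ι, g (s.piecewise x y) = g y := by
    intro s
    induction s using Finset.induction_on with
    | empty => simp
    | insert j s _ ih => rw [Finset.piecewise_insert, h, ih]
  simpa using key Finset.univ

/-- A function on binary vectors that changes sign under every coordinate flip is determined
by its value at `0`, up to the sign given by the total parity. -/
theorem eq_parity_sign_mul_zero {ι : Type*} [Fintype ι] [DecidableEq ι]
    {f : (ι → ZMod 2) → ℝ}
    (h : ∀ j x, f (Function.update x j 0) + f (Function.update x j 1) = 0) (x : ι → ZMod 2) :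
    f x = (if ∑ i, x i = 0 then 1 else -1) * f 0 := by
  have flip : ∀ (x : ι → ZMod 2) (j : ι) (b : ZMod 2),
      (if ∑ i, Function.update x j b i = 0 then (1 : ℝ) else -1) * f (Function.update x j b) =
        (if ∑ i, x i = 0 then 1 else -1) * f x := by
    intro x j b
    have zero_one :
        (if ∑ i, Function.update x j 0 i = 0 then (1 : ℝ) else -1) * f (Function.update x j 0) =
        (if ∑ i, Function.update x j 1 i = 0 then 1 else -1) * f (Function.update x j 1) := by
      simp only [Finset.sum_update_of_mem (Finset.mem_univ j)]
      have hf := h j x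
      have parity : ∀ a : ZMod 2, (1 + a = 0) ↔ ¬ (0 + a = 0) := by decide
      simp only [parity]
      split_ifs <;> linarith
    have cases_zero : ∀ c : ZMod 2, c = 0 ∨ c = 1 := by decide
    have all_eq : ∀ c : ZMod 2,
        (if ∑ i, Function.update x j c i = 0 then (1 : ℝ) else -1) * f (Function.update x j c) =
        (if ∑ i, Function.update x j 0 i = 0 then 1 else -1) * f (Function.update x j 0) := by
      intro c
      rcases cases_zero c with rfl | rfl
      · rfl
      · exact zero_one.symm
    have hx := all_eq (x j)
    rw [Function.update_eq_self] at hx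
    rw [all_eq b, hx]
  have hx := eq_of_update_eq
    (g := fun x => (if ∑ i, x i = 0 then (1 : ℝ) else -1) * f x) flip x 0
  simp only [Pi.zero_apply, Finset.sum_const_zero, if_true, one_mul] at hx
  rw [← hx]
  split_ifs <;> ring

/-- Induction step in the proof that parity-check probabilities determine a pmf:
if two pmfs `P`, `Q` on binary strings of length `n` have equal single-coordinate
marginals and assign equal probability to the even total-parity event, then `P = Q`. -/
theorem pmf_eq_of_marginals_and_total_parity (n : ℕ) (P Q : (Fin n → ZMod 2) → ℝ)
    (hPnn : ∀ x, 0 ≤ P x) (hQnn : ∀ x, 0 ≤ Q x)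
    (hPsum : ∑ x, P x = 1) (hQsum : ∑ x, Q x = 1)
    (hmarg : ∀ (j : Fin n) (x : Fin n → ZMod 2),
      P (Function.update x j 0) + P (Function.update x j 1) =
      Q (Function.update x j 0) + Q (Function.update x j 1))
    (hparity :
      ∑ x ∈ Finset.univ.filter (fun x : Fin n → ZMod 2 => ∑ i, x i = 0), P x =
      ∑ x ∈ Finset.univ.filter (fun x : Fin n → ZMod 2 => ∑ i, x i = 0), Q x) :
    P = Q := by
  have sign := eq_parity_sign_mul_zero (f := fun x => P x - Q x)
    (fun j x => by linarith [hmarg j x])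
  have sum_zero : ∑ x ∈ Finset.univ.filter (fun x : Fin n → ZMod 2 => ∑ i, x i = 0),
      (P x - Q x) = 0 := by
    rw [Finset.sum_sub_distrib, hparity, sub_self]
  have sum_const : ∑ x ∈ Finset.univ.filter (fun x : Fin n → ZMod 2 => ∑ i, x i = 0),
      (P x - Q x) = ∑ x ∈ Finset.univ.filter (fun x : Fin n → ZMod 2 => ∑ i, x i = 0),
      (P 0 - Q 0) := by
    refine Finset.sum_congr rfl fun x hx => ?_
    rw [sign x, if_pos (Finset.mem_filter.mp hx).2, one_mul]
  rw [sum_const, Finset.sum_const, smul_eq_zero] at sum_zero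
  have card_ne :
      (Finset.univ.filter (fun x : Fin n → ZMod 2 => ∑ i, x i = 0)).card ≠ 0 :=
    Finset.card_ne_zero_of_mem (a := 0) (by simp)
  have at_zero := sum_zero.resolve_left card_ne
  funext x
  have hx := sign x
  simp only [at_zero, mul_zero] at hx
  exact sub_eq_zero.mp hx
end

section
/- Let P and Q be probability mass functions on binary strings of length n with equal single-coordinate marginals, i.e. for every coordinate j and every string x, P(x with coordinate j set to 0) + P(x with coordinate j set to 1) = Q(x with coordinate j set to 0) + Q(x with coordinate j set to 1). Then for all strings x and y, P x − Q x = (−1)^{d(x,y)} · (P y − Q y), where d(x,y) is the Hamming distance between x and y (the number of coordinates on which they differ). In particular P − Q takes one constant value on all even-weight strings and the negated value on all odd-weight strings. -/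
/-- A function on binary strings whose two values along every edge of the cube sum to zero
alternates in sign according to Hamming distance. -/
theorem eq_neg_one_pow_hamming_mul_of_update_add_eq_zero {ι : Type*} [Fintype ι] [DecidableEq ι]
    {R : Type*} [Ring R] {f : (ι → ZMod 2) → R}
    (hf : ∀ j x, f (Function.update x j 0) + f (Function.update x j 1) = 0) (x y : ι → ZMod 2) :
    f x = (-1) ^ (Finset.univ.filter (fun i => x i ≠ y i)).card * f y := by
  have flip (x : ι → ZMod 2) (j : ι) (b : ZMod 2) (hb : x j ≠ b) :
      f x = -f (Function.update x j b) := by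
    have two_values : ∀ c : ZMod 2, c = 0 ∨ c = 1 := by decide
    have h := hf j x
    have hx := Function.update_eq_self j x
    rcases two_values (x j) with hc | hc <;> rcases two_values b with rfl | rfl
    · exact absurd hc hb
    · rw [hc] at hx
      rw [hx] at h
      exact eq_neg_of_add_eq_zero_left h
    · rw [hc] at hx
      rw [hx] at h
      exact eq_neg_of_add_eq_zero_right h
    · exact absurd hc hb
  generalize hs : Finset.univ.filter (fun i => x i ≠ y i) = s
  induction s using Finset.induction_on generalizing x with
  | empty =>
    have hxy : x = y := by
      funext i
      by_contra hi
      have : i ∈ Finset.univ.filter (fun i => x i ≠ y i) := by simpa using hi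
      simp [hs] at this
    simp [hxy]
  | insert a s ha ih =>
    have hmem (i : ι) : x i ≠ y i ↔ i = a ∨ i ∈ s := by
      simpa using Finset.ext_iff.mp hs i
    have hs' : Finset.univ.filter (fun i => Function.update x a (y a) i ≠ y i) = s := by
      ext i
      rcases eq_or_ne i a with rfl | hi
      · simp [ha]
      · simpa [hi] using hmem i
    rw [flip x a (y a) ((hmem a).2 (Or.inl rfl)), ih _ hs', Finset.card_insert_of_notMem ha,
      pow_succ']
    simp


/-- If two pmfs `P`, `Q` on binary strings of length `n` have equal single-coordinate
marginals, then the difference `P − Q` alternates in sign according to Hamming distance: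
`P x − Q x = (−1)^{d(x,y)} (P y − Q y)` for all strings `x`, `y`. -/
theorem pmf_diff_alternates_with_hamming_distance (n : ℕ) (P Q : (Fin n → ZMod 2) → ℝ)
    (hPnn : ∀ x, 0 ≤ P x) (hQnn : ∀ x, 0 ≤ Q x)
    (hPsum : ∑ x, P x = 1) (hQsum : ∑ x, Q x = 1)
    (hmarg : ∀ (j : Fin n) (x : Fin n → ZMod 2),
      P (Function.update x j 0) + P (Function.update x j 1) =
      Q (Function.update x j 0) + Q (Function.update x j 1)) :
    ∀ x y : Fin n → ZMod 2,
      P x - Q x =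
        (-1 : ℝ) ^ (Finset.univ.filter (fun i : Fin n => x i ≠ y i)).card * (P y - Q y) := by
  exact eq_neg_one_pow_hamming_mul_of_update_add_eq_zero (f := fun x => P x - Q x)
    fun j x => by linarith [hmarg j x]
end

section
/- Let P and Q be probability mass functions on binary strings of length n with equal single-coordinate marginals, i.e. for every coordinate j and every string x, P(x with coordinate j set to 0) + P(x with coordinate j set to 1) = Q(x with coordinate j set to 0) + Q(x with coordinate j set to 1). If there exists a string x₀ of even parity (∑_i x₀ i = 0 in ZMod 2) with P x₀ < Q x₀, then P x < Q x for every string x of even parity, and P y > Q y for every string y of odd parity (∑_i y i = 1). -/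
/-- A real function on binary strings that changes sign whenever a coordinate is flipped is,
up to its value at `0`, the sign character of the parity. -/
theorem eq_ite_parity_of_update_add_update_eq_zero {n : ℕ} {f : (Fin n → ZMod 2) → ℝ}
    (hf : ∀ j x, f (Function.update x j 0) + f (Function.update x j 1) = 0)
    (x : Fin n → ZMod 2) : f x = if ∑ i, x i = 0 then f 0 else -f 0 := by
  have key : ∀ s : Finset (Fin n),
      f (s.piecewise x 0) = if ∑ i ∈ s, x i = 0 then f 0 else -f 0 := by
    intro s
    induction s using Finset.induction_on with
    | empty => simp
    | insert j s hj ih =>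
      have h_off : Function.update (s.piecewise x 0) j 0 = s.piecewise x 0 := by
        simp [hj]
      have h_flip := hf j (s.piecewise x 0)
      rw [h_off] at h_flip
      rw [Finset.piecewise_insert, Finset.sum_insert hj]
      have h_bit : ∀ a : ZMod 2, a = 0 ∨ a = 1 := by decide
      rcases h_bit (x j) with hx | hx
      · rw [hx, h_off, ih, zero_add]
      · rw [hx, eq_neg_of_add_eq_zero_right h_flip, ih]
        rcases h_bit (∑ i ∈ s, x i) with hs | hs
        · simp [hs]
        · rw [hs, if_neg one_ne_zero, neg_neg, if_pos (by decide)]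
  simpa using key Finset.univ

/-- If two pmfs `P`, `Q` on binary strings of length `n` have equal single-coordinate
marginals and `P x₀ < Q x₀` for some even-parity string `x₀`, then `P x < Q x` for
every even-parity string `x` and `P y > Q y` for every odd-parity string `y`. -/
theorem pmf_strict_ineq_propagates_by_parity (n : ℕ) (P Q : (Fin n → ZMod 2) → ℝ)
    (hPnn : ∀ x, 0 ≤ P x) (hQnn : ∀ x, 0 ≤ Q x)
    (hPsum : ∑ x, P x = 1) (hQsum : ∑ x, Q x = 1)
    (hmarg : ∀ (j : Fin n) (x : Fin n → ZMod 2),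
      P (Function.update x j 0) + P (Function.update x j 1) =
      Q (Function.update x j 0) + Q (Function.update x j 1))
    (x₀ : Fin n → ZMod 2) (hx₀ : ∑ i, x₀ i = 0) (hlt : P x₀ < Q x₀) :
    (∀ x : Fin n → ZMod 2, ∑ i, x i = 0 → P x < Q x) ∧
    (∀ y : Fin n → ZMod 2, ∑ i, y i = 1 → P y > Q y) := by
  have h_diff := eq_ite_parity_of_update_add_update_eq_zero (f := fun x => P x - Q x)
    fun j x => by linarith [hmarg j x]
  have h₀ := h_diff x₀
  rw [if_pos hx₀] at h₀
  refine ⟨fun x hx => ?_, fun y hy => ?_⟩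
  · have h := h_diff x
    rw [if_pos hx] at h
    linarith
  · have h := h_diff y
    rw [hy, if_neg one_ne_zero] at h
    linarith
end

section
/- Let M be a perfect matching on Fin n with stabilizer subgroup S_M of 𝒫ₙ, and let (g_k)_{k ∈ K} be a finite family of encoded Pauli strings g_k = (x_k, z_k) in 𝒫ₙ. For a subset S ⊆ K, if for every edge e ∈ M the three sums ∑_{k∈S} |e ∩ φ_X(g_k)|, ∑_{k∈S} |e ∩ φ_Y(g_k)|, and ∑_{k∈S} |e ∩ φ_Z(g_k)| are all even, then the product ∑_{k∈S} g_k (the group operation in 𝒫ₙ) belongs to S_M. (This is the 'if' direction of the supplemental Claim characterizing when ±g_S lies in the stabilizer of the product of Bell pairs along M.) -/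
/-- The `ZMod 2` indicator function of a finite set of qubits. -/
def chi {n : ℕ} (e : Finset (Fin n)) : Fin n → ZMod 2 :=
  fun i => if i ∈ e then 1 else 0

/-- The subgroup of `𝒫ₙ = (Fin n → ZMod 2) × (Fin n → ZMod 2)` generated by the
elements `(χ_e, 0)` and `(0, χ_e)` for the edges `e` of a matching `M`. -/
def bellStabilizer {n : ℕ} (M : Finset (Finset (Fin n))) :
    AddSubgroup ((Fin n → ZMod 2) × (Fin n → ZMod 2)) :=
  AddSubgroup.closure
    {p | ∃ e ∈ M, p = ((chi e, 0) : (Fin n → ZMod 2) × (Fin n → ZMod 2)) ∨ p = (0, chi e)}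

/-- The set of qubits on which an encoded Pauli string acts by Pauli-`X`. -/
def phiX {n : ℕ} (g : (Fin n → ZMod 2) × (Fin n → ZMod 2)) : Finset (Fin n) :=
  Finset.univ.filter (fun i => g.1 i = 1 ∧ g.2 i = 0)

/-- The set of qubits on which an encoded Pauli string acts by Pauli-`Y`. -/
def phiY {n : ℕ} (g : (Fin n → ZMod 2) × (Fin n → ZMod 2)) : Finset (Fin n) :=
  Finset.univ.filter (fun i => g.1 i = 1 ∧ g.2 i = 1)

/-- The set of qubits on which an encoded Pauli string acts by Pauli-`Z`. -/
def phiZ {n : ℕ} (g : (Fin n → ZMod 2) × (Fin n → ZMod 2)) : Finset (Fin n) :=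
  Finset.univ.filter (fun i => g.1 i = 0 ∧ g.2 i = 1)

theorem sum_fst_eq_card_phiX_add_card_phiY {n : ℕ} (e : Finset (Fin n))
    (g : (Fin n → ZMod 2) × (Fin n → ZMod 2)) :
    ∑ i ∈ e, g.1 i = ((e ∩ phiX g).card + (e ∩ phiY g).card : ℕ) := by
  have key : ∀ a b : ZMod 2,
      a = (if a = 1 ∧ b = 0 then 1 else 0) + (if a = 1 ∧ b = 1 then 1 else 0) := by decide
  simp only [phiX, phiY, Finset.inter_filter, Finset.inter_univ, Finset.card_filter]
  push_cast
  rw [← Finset.sum_add_distrib]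
  exact Finset.sum_congr rfl fun i _ => key _ _

theorem sum_snd_eq_card_phiZ_add_card_phiY {n : ℕ} (e : Finset (Fin n))
    (g : (Fin n → ZMod 2) × (Fin n → ZMod 2)) :
    ∑ i ∈ e, g.2 i = ((e ∩ phiZ g).card + (e ∩ phiY g).card : ℕ) := by
  have key : ∀ a b : ZMod 2,
      b = (if a = 0 ∧ b = 1 then 1 else 0) + (if a = 1 ∧ b = 1 then 1 else 0) := by decide
  simp only [phiZ, phiY, Finset.inter_filter, Finset.inter_univ, Finset.card_filter]
  push_cast
  rw [← Finset.sum_add_distrib]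
  exact Finset.sum_congr rfl fun i _ => key _ _

/-- A vector over `ZMod 2` whose sum over every edge of a perfect matching vanishes lies in every
subgroup containing the edge indicators. -/
theorem mem_of_chi_mem_of_sum_eq_zero {n : ℕ} {M : Finset (Finset (Fin n))}
    (hcard : ∀ e ∈ M, e.card = 2) (hcover : ∀ i : Fin n, ∃! e, e ∈ M ∧ i ∈ e)
    {H : AddSubgroup (Fin n → ZMod 2)} (hH : ∀ e ∈ M, chi e ∈ H)
    {w : Fin n → ZMod 2} (hw : ∀ e ∈ M, ∑ i ∈ e, w i = 0) : w ∈ H := by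
  have hconst : ∀ e ∈ M, ∃ c : ZMod 2, ∀ i ∈ e, w i = c := by
    intro e he
    obtain ⟨a, b, hab, rfl⟩ := Finset.card_eq_two.mp (hcard e he)
    have hsum := hw _ he
    rw [Finset.sum_pair hab, CharTwo.add_eq_zero] at hsum
    exact ⟨w a, by simp [hsum]⟩
  choose! c hc using hconst
  have hsum : w = ∑ e ∈ M, c e • chi e := by
    funext i
    obtain ⟨e, ⟨he, hie⟩, huniq⟩ := hcover i
    rw [Finset.sum_apply, Finset.sum_eq_single_of_mem e he]
    · simp [chi, hie, hc e he i hie]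
    · intro e' he' hne
      have hi : i ∉ e' := fun hi => hne (huniq e' ⟨he', hi⟩)
      simp [chi, hi]
  rw [hsum]
  exact sum_mem fun e he => ZMod.smul_mem (hH e he) (c e)

/-- 'If' direction of the supplemental Claim: if for every edge `e` of a perfect
matching `M` the three counts `∑_{k∈S} |e ∩ φ_X(g_k)|`, `∑_{k∈S} |e ∩ φ_Y(g_k)|`,
`∑_{k∈S} |e ∩ φ_Z(g_k)|` are all even, then `∑_{k∈S} g_k` lies in the Bell-pair
stabilizer subgroup `S_M`. -/
theorem sum_mem_bellStabilizer_of_even_counts (n : ℕ) (M : Finset (Finset (Fin n)))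
    (hcard : ∀ e ∈ M, e.card = 2)
    (hcover : ∀ i : Fin n, ∃! e, e ∈ M ∧ i ∈ e)
    {K : Type} [Fintype K] [DecidableEq K]
    (g : K → (Fin n → ZMod 2) × (Fin n → ZMod 2)) (S : Finset K)
    (hX : ∀ e ∈ M, Even (∑ k ∈ S, (e ∩ phiX (g k)).card))
    (hY : ∀ e ∈ M, Even (∑ k ∈ S, (e ∩ phiY (g k)).card))
    (hZ : ∀ e ∈ M, Even (∑ k ∈ S, (e ∩ phiZ (g k)).card)) :
    (∑ k ∈ S, g k) ∈ bellStabilizer M := by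
  have hfst : (∑ k ∈ S, g k).1 ∈ (bellStabilizer M).comap (AddMonoidHom.inl _ _) := by
    have hchi : ∀ e ∈ M, chi e ∈ (bellStabilizer M).comap (AddMonoidHom.inl _ _) :=
      fun e he => AddSubgroup.subset_closure
        (show AddMonoidHom.inl _ _ (chi e) ∈ _ from ⟨e, he, Or.inl rfl⟩)
    refine mem_of_chi_mem_of_sum_eq_zero hcard hcover hchi fun e he => ?_
    simp only [Prod.fst_sum, Finset.sum_apply]
    rw [Finset.sum_comm]
    simp only [sum_fst_eq_card_phiX_add_card_phiY]
    rw [← Nat.cast_sum, ZMod.natCast_eq_zero_iff_even, Finset.sum_add_distrib]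
    exact (hX e he).add (hY e he)
  have hsnd : (∑ k ∈ S, g k).2 ∈ (bellStabilizer M).comap (AddMonoidHom.inr _ _) := by
    have hchi : ∀ e ∈ M, chi e ∈ (bellStabilizer M).comap (AddMonoidHom.inr _ _) :=
      fun e he => AddSubgroup.subset_closure
        (show AddMonoidHom.inr _ _ (chi e) ∈ _ from ⟨e, he, Or.inr rfl⟩)
    refine mem_of_chi_mem_of_sum_eq_zero hcard hcover hchi fun e he => ?_
    simp only [Prod.snd_sum, Finset.sum_apply]
    rw [Finset.sum_comm]
    simp only [sum_snd_eq_card_phiZ_add_card_phiY]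
    rw [← Nat.cast_sum, ZMod.natCast_eq_zero_iff_even, Finset.sum_add_distrib]
    exact (hZ e he).add (hY e he)
  rw [← Prod.fst_add_snd (∑ k ∈ S, g k)]
  exact add_mem hfst hsnd
end

section
/- Let M be a perfect matching on Fin n and let (g_k)_{k ∈ K} be a finite family of encoded Pauli strings g_k = (x_k, z_k) in 𝒫ₙ. For a subset S ⊆ K, the product ∑_{k∈S} g_k belongs to the stabilizer subgroup S_M if and only if for every edge e ∈ M both ∑_{k∈S} (|e ∩ φ_X(g_k)| + |e ∩ φ_Y(g_k)|) and ∑_{k∈S} (|e ∩ φ_Y(g_k)| + |e ∩ φ_Z(g_k)|) are even. (Refined count characterization of stabilizer membership for products of Pauli strings on a Bell-pair network.) -/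
theorem sum_chi_eq_zero_of_matching {n : ℕ} {M : Finset (Finset (Fin n))}
    (hcard : ∀ e ∈ M, e.card = 2) (hcover : ∀ i : Fin n, ∃! e, e ∈ M ∧ i ∈ e)
    {e f : Finset (Fin n)} (he : e ∈ M) (hf : f ∈ M) : ∑ i ∈ e, chi f i = 0 := by
  by_cases h : e = f
  · subst h
    have hsum : ∑ i ∈ e, chi e i = (e.card : ZMod 2) := by
      rw [Finset.card_eq_sum_ones, Nat.cast_sum]
      exact Finset.sum_congr rfl fun i hi => by simp [chi, hi]
    rw [hsum, hcard e he]
    rfl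
  · refine Finset.sum_eq_zero fun i hi => ?_
    have : i ∉ f := fun hif => h ((hcover i).unique ⟨he, hi⟩ ⟨hf, hif⟩)
    simp [chi, this]

/-- A vector with zero sum on each edge of a perfect matching is the sum of the indicators of the
edges meeting its support. -/
theorem eq_sum_chi_of_forall_sum_eq_zero {n : ℕ} {M : Finset (Finset (Fin n))}
    (hcard : ∀ e ∈ M, e.card = 2) (hcover : ∀ i : Fin n, ∃! e, e ∈ M ∧ i ∈ e)
    {a : Fin n → ZMod 2} (ha : ∀ e ∈ M, ∑ i ∈ e, a i = 0) :
    a = ∑ e ∈ M with ∃ i ∈ e, a i = 1, chi e := by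
  funext j
  obtain ⟨e, ⟨he, hje⟩, huniq⟩ := hcover j
  have hconst : ∀ i ∈ e, a i = a j := by
    obtain ⟨u, v, huv, rfl⟩ := Finset.card_eq_two.mp (hcard e he)
    have hsum := ha _ he
    rw [Finset.sum_pair huv, CharTwo.add_eq_zero] at hsum
    intro i hi
    simp only [Finset.mem_insert, Finset.mem_singleton] at hi hje
    rcases hi with rfl | rfl <;> rcases hje with rfl | rfl <;> simp [hsum]
  rw [Finset.sum_apply, Finset.sum_filter, Finset.sum_eq_single_of_mem e he]
  · have hiff : (∃ i ∈ e, a i = 1) ↔ a j = 1 :=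
      ⟨fun ⟨i, hi, h⟩ => hconst i hi ▸ h, fun h => ⟨j, hje, h⟩⟩
    have hbit : ∀ x : ZMod 2, x = if x = 1 then 1 else 0 := by decide
    simpa [hiff, chi, hje] using hbit (a j)
  · intro f hf hfe
    have : j ∉ f := fun hjf => hfe (huniq f ⟨hf, hjf⟩)
    simp [chi, this]

/-- The stabilizer group of a product of Bell pairs consists of the Pauli strings whose `X`-part
and `Z`-part have zero sum on every edge. -/
theorem mem_bellStabilizer_iff {n : ℕ} {M : Finset (Finset (Fin n))}
    (hcard : ∀ e ∈ M, e.card = 2) (hcover : ∀ i : Fin n, ∃! e, e ∈ M ∧ i ∈ e)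
    (p : (Fin n → ZMod 2) × (Fin n → ZMod 2)) :
    p ∈ bellStabilizer M ↔ ∀ e ∈ M, ∑ i ∈ e, p.1 i = 0 ∧ ∑ i ∈ e, p.2 i = 0 := by
  constructor
  · intro hp e he
    induction hp using AddSubgroup.closure_induction with
    | mem x hx =>
      obtain ⟨f, hf, rfl | rfl⟩ := hx <;>
        simp [sum_chi_eq_zero_of_matching hcard hcover he hf]
    | zero => simp
    | add x y _ _ hx hy => simp [Finset.sum_add_distrib, hx, hy]
    | neg x _ hx => simp [hx]
  · intro h
    have hX : ((p.1, 0) : (Fin n → ZMod 2) × (Fin n → ZMod 2)) ∈ bellStabilizer M := by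
      rw [eq_sum_chi_of_forall_sum_eq_zero hcard hcover fun e he => (h e he).1]
      change AddMonoidHom.inl (Fin n → ZMod 2) (Fin n → ZMod 2) _ ∈ _
      rw [map_sum]
      exact AddSubgroup.sum_mem _ fun e he =>
        AddSubgroup.subset_closure ⟨e, (Finset.mem_filter.mp he).1, Or.inl rfl⟩
    have hZ : ((0, p.2) : (Fin n → ZMod 2) × (Fin n → ZMod 2)) ∈ bellStabilizer M := by
      rw [eq_sum_chi_of_forall_sum_eq_zero hcard hcover fun e he => (h e he).2]
      change AddMonoidHom.inr (Fin n → ZMod 2) (Fin n → ZMod 2) _ ∈ _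
      rw [map_sum]
      exact AddSubgroup.sum_mem _ fun e he =>
        AddSubgroup.subset_closure ⟨e, (Finset.mem_filter.mp he).1, Or.inr rfl⟩
    simpa using AddSubgroup.add_mem _ hX hZ

theorem natCast_card_inter_filter {n : ℕ} (e : Finset (Fin n)) (P : Fin n → Prop)
    [DecidablePred P] :
    ((e ∩ Finset.univ.filter P).card : ZMod 2) = ∑ i ∈ e, if P i then 1 else 0 := by
  rw [Finset.inter_filter, Finset.inter_univ, Finset.natCast_card_filter]

theorem natCast_card_inter_phiX_add_phiY {n : ℕ} (e : Finset (Fin n))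
    (g : (Fin n → ZMod 2) × (Fin n → ZMod 2)) :
    (((e ∩ phiX g).card + (e ∩ phiY g).card : ℕ) : ZMod 2) = ∑ i ∈ e, g.1 i := by
  have hbit : ∀ x z : ZMod 2, ((if x = 1 ∧ z = 0 then 1 else 0) +
      (if x = 1 ∧ z = 1 then 1 else 0) : ZMod 2) = x := by decide
  rw [Nat.cast_add, phiX, phiY, natCast_card_inter_filter, natCast_card_inter_filter,
    ← Finset.sum_add_distrib]
  exact Finset.sum_congr rfl fun i _ => hbit _ _

theorem natCast_card_inter_phiY_add_phiZ {n : ℕ} (e : Finset (Fin n))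
    (g : (Fin n → ZMod 2) × (Fin n → ZMod 2)) :
    (((e ∩ phiY g).card + (e ∩ phiZ g).card : ℕ) : ZMod 2) = ∑ i ∈ e, g.2 i := by
  have hbit : ∀ x z : ZMod 2, ((if x = 1 ∧ z = 1 then 1 else 0) +
      (if x = 0 ∧ z = 1 then 1 else 0) : ZMod 2) = z := by decide
  rw [Nat.cast_add, phiY, phiZ, natCast_card_inter_filter, natCast_card_inter_filter,
    ← Finset.sum_add_distrib]
  exact Finset.sum_congr rfl fun i _ => hbit _ _

/-- Refined count characterization of stabilizer membership: for a perfect matching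
`M` on `Fin n`, the product `∑_{k∈S} g_k` lies in the Bell-pair stabilizer `S_M` iff
for every edge `e ∈ M` both `∑_{k∈S} (|e ∩ φ_X(g_k)| + |e ∩ φ_Y(g_k)|)` and
`∑_{k∈S} (|e ∩ φ_Y(g_k)| + |e ∩ φ_Z(g_k)|)` are even. -/
theorem sum_mem_bellStabilizer_iff_even_counts (n : ℕ) (M : Finset (Finset (Fin n)))
    (hcard : ∀ e ∈ M, e.card = 2)
    (hcover : ∀ i : Fin n, ∃! e, e ∈ M ∧ i ∈ e)
    {K : Type} [Fintype K] [DecidableEq K]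
    (g : K → (Fin n → ZMod 2) × (Fin n → ZMod 2)) (S : Finset K) :
    (∑ k ∈ S, g k) ∈ bellStabilizer M ↔
      ∀ e ∈ M,
        Even (∑ k ∈ S, ((e ∩ phiX (g k)).card + (e ∩ phiY (g k)).card)) ∧
        Even (∑ k ∈ S, ((e ∩ phiY (g k)).card + (e ∩ phiZ (g k)).card)) := by
  rw [mem_bellStabilizer_iff hcard hcover]
  refine forall₂_congr fun e _ => ?_
  simp only [← ZMod.natCast_eq_zero_iff_even, Nat.cast_sum, natCast_card_inter_phiX_add_phiY,
    natCast_card_inter_phiY_add_phiZ, Prod.fst_sum, Prod.snd_sum, Finset.sum_apply]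
  rw [Finset.sum_comm, Finset.sum_comm (s := e)]
end

section
/- Let M be a perfect matching on Fin n, (g_k)_{k ∈ K} a finite family of encoded Pauli strings in 𝒫ₙ, and ι_k ∈ ZMod 2 fixed constants. Let S ⊆ K and suppose that for every edge e ∈ M the three sums ∑_{k∈S} |e ∩ φ_X(g_k)|, ∑_{k∈S} |e ∩ φ_Y(g_k)|, ∑_{k∈S} |e ∩ φ_Z(g_k)| are all even. Then for EVERY assignment λ of a bit triple (X_e, Y_e, Z_e) ∈ (ZMod 2)³ to each edge e ∈ M, the simulated outputs satisfy ∑_{k∈S} B_k(λ) = ∑_{k∈S} ι_k in ZMod 2; i.e. the random part of the classical model cancels. (Supplemental claim: if g_S is in the stabilizer, the model's parity output is deterministic.) -/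
/-- The classical model's simulated output for the Pauli string `g` with offset `ι`,
given an assignment `lam` of a bit triple `(X_e, Y_e, Z_e)` to each edge of `M`:
`B = ∑_{e ∈ M} (|e ∩ φ_X(g)|·X_e + |e ∩ φ_Y(g)|·Y_e + |e ∩ φ_Z(g)|·Z_e) + ι` in `ZMod 2`. -/
def simOutput {n : ℕ} (M : Finset (Finset (Fin n)))
    (g : (Fin n → ZMod 2) × (Fin n → ZMod 2)) (ι : ZMod 2)
    (lam : {e // e ∈ M} → ZMod 2 × ZMod 2 × ZMod 2) : ZMod 2 :=
  (∑ e : {e // e ∈ M},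
      (((e.1 ∩ phiX g).card : ZMod 2) * (lam e).1 +
       ((e.1 ∩ phiY g).card : ZMod 2) * (lam e).2.1 +
       ((e.1 ∩ phiZ g).card : ZMod 2) * (lam e).2.2)) + ι

theorem sum_natCast_mul_eq_zero_of_even {K : Type*} {S : Finset K} {f : K → ℕ}
    (h : Even (∑ k ∈ S, f k)) (a : ZMod 2) : ∑ k ∈ S, (f k : ZMod 2) * a = 0 := by
  rw [← Finset.sum_mul, ← Nat.cast_sum, ZMod.natCast_eq_zero_iff_even.mpr h, zero_mul]

/-- Supplemental claim (deterministic case): if for every edge `e` of a perfect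
matching `M` the three counts `∑_{k∈S} |e ∩ φ_X(g_k)|`, `∑_{k∈S} |e ∩ φ_Y(g_k)|`,
`∑_{k∈S} |e ∩ φ_Z(g_k)|` are all even, then for every assignment `lam` of bit triples
to the edges, the simulated outputs satisfy `∑_{k∈S} B_k(lam) = ∑_{k∈S} ι_k`. -/
theorem simOutput_parity_deterministic (n : ℕ) (M : Finset (Finset (Fin n)))
    (hcard : ∀ e ∈ M, e.card = 2)
    (hcover : ∀ i : Fin n, ∃! e, e ∈ M ∧ i ∈ e)
    {K : Type} [Fintype K] [DecidableEq K]
    (g : K → (Fin n → ZMod 2) × (Fin n → ZMod 2)) (ι : K → ZMod 2) (S : Finset K)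
    (hX : ∀ e ∈ M, Even (∑ k ∈ S, (e ∩ phiX (g k)).card))
    (hY : ∀ e ∈ M, Even (∑ k ∈ S, (e ∩ phiY (g k)).card))
    (hZ : ∀ e ∈ M, Even (∑ k ∈ S, (e ∩ phiZ (g k)).card)) :
    ∀ lam : {e // e ∈ M} → ZMod 2 × ZMod 2 × ZMod 2,
      ∑ k ∈ S, simOutput M (g k) (ι k) lam = ∑ k ∈ S, ι k := by
  intro lam
  simp only [simOutput]
  rw [Finset.sum_add_distrib, Finset.sum_comm, add_eq_right]
  refine Finset.sum_eq_zero fun e _ => ?_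
  rw [Finset.sum_add_distrib, Finset.sum_add_distrib,
    sum_natCast_mul_eq_zero_of_even (hX e.1 e.2),
    sum_natCast_mul_eq_zero_of_even (hY e.1 e.2),
    sum_natCast_mul_eq_zero_of_even (hZ e.1 e.2), add_zero, add_zero]
end

section
/- Let M be a perfect matching on Fin n, (g_k)_{k ∈ K} a finite family of encoded Pauli strings in 𝒫ₙ, ι_k ∈ ZMod 2 constants, and S ⊆ K. Suppose the bit triples (X_e, Y_e, Z_e)_{e ∈ M} are drawn independently and uniformly at random from ZMod 2 (i.e. λ is distributed according to the uniform pmf on the finite type of all assignments, each assignment having probability (1/8)^{|M|}). If there exists an edge e ∈ M for which at least one of the three sums ∑_{k∈S} |e ∩ φ_X(g_k)|, ∑_{k∈S} |e ∩ φ_Y(g_k)|, ∑_{k∈S} |e ∩ φ_Z(g_k)| is odd, then the probability that ∑_{k∈S} B_k(λ) = 0 equals 1/2. (Supplemental claim: if ±g_S is not in the stabilizer, the classical model's parity output is an unbiased coin flip.) -/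
/-- A `ZMod 2`-valued function that some translation flips vanishes on exactly half of the group. -/
theorem two_mul_card_filter_eq_zero_of_add_eq_add_one {G : Type*} [AddGroup G] [Fintype G]
    (f : G → ZMod 2) (d : G) (hd : ∀ x, f (x + d) = f x + 1) :
    2 * (Finset.univ.filter fun x => f x = 0).card = Fintype.card G := by
  have hflip : ∀ a : ZMod 2, a = 0 ↔ ¬ a + 1 = 0 := by decide
  have hcompl : (Finset.univ.filter fun x => f x = 0).card =
      (Finset.univ.filter fun x => ¬ f x = 0).card :=
    Finset.card_equiv (Equiv.addRight d) fun x => by simpa [hd] using hflip (f x)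
  have hsum := Finset.card_filter_add_card_filter_not (s := Finset.univ) fun x => f x = 0
  rw [Finset.card_univ] at hsum
  omega

/-- Changing the bit triple of one edge `e` by `t` changes the simulated output by the
contribution of `t` at `e`. -/
theorem simOutput_add_single {n : ℕ} (M : Finset (Finset (Fin n)))
    (g : (Fin n → ZMod 2) × (Fin n → ZMod 2)) (ι : ZMod 2)
    (lam : {e // e ∈ M} → ZMod 2 × ZMod 2 × ZMod 2) (e : {e // e ∈ M})
    (t : ZMod 2 × ZMod 2 × ZMod 2) :
    simOutput M g ι (lam + Pi.single e t) = simOutput M g ι lam +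
      (((e.1 ∩ phiX g).card : ZMod 2) * t.1 + ((e.1 ∩ phiY g).card : ZMod 2) * t.2.1 +
        ((e.1 ∩ phiZ g).card : ZMod 2) * t.2.2) := by
  have hsingle := Finset.sum_eq_single_of_mem
    (f := fun e' : {e // e ∈ M} =>
      ((e'.1 ∩ phiX g).card : ZMod 2) * ((Pi.single e t : {e // e ∈ M} → _) e').1 +
      ((e'.1 ∩ phiY g).card : ZMod 2) * ((Pi.single e t : {e // e ∈ M} → _) e').2.1 +
      ((e'.1 ∩ phiZ g).card : ZMod 2) * ((Pi.single e t : {e // e ∈ M} → _) e').2.2)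
    e (Finset.mem_univ e) fun e' _ he' => by simp [Pi.single_eq_of_ne he']
  simp only [Pi.single_eq_same] at hsingle
  rw [← hsingle, simOutput, simOutput, add_right_comm, ← Finset.sum_add_distrib]
  congr 1
  refine Finset.sum_congr rfl fun e' _ => ?_
  simp only [Pi.add_apply, Prod.fst_add, Prod.snd_add]
  ring

/-- Supplemental claim (coin-flip case): if the bit triples are drawn uniformly and
independently (each joint assignment having probability `(1/8)^{|M|}`) and for some
edge `e ∈ M` at least one of the counts `∑_{k∈S} |e ∩ φ_X(g_k)|`,
`∑_{k∈S} |e ∩ φ_Y(g_k)|`, `∑_{k∈S} |e ∩ φ_Z(g_k)|` is odd, then the probability that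
`∑_{k∈S} B_k(lam) = 0` equals `1/2`. -/
theorem simOutput_parity_unbiased (n : ℕ) (M : Finset (Finset (Fin n)))
    (hcard : ∀ e ∈ M, e.card = 2)
    (hcover : ∀ i : Fin n, ∃! e, e ∈ M ∧ i ∈ e)
    {K : Type} [Fintype K] [DecidableEq K]
    (g : K → (Fin n → ZMod 2) × (Fin n → ZMod 2)) (ι : K → ZMod 2) (S : Finset K)
    (hodd : ∃ e ∈ M,
        ¬ Even (∑ k ∈ S, (e ∩ phiX (g k)).card) ∨
        ¬ Even (∑ k ∈ S, (e ∩ phiY (g k)).card) ∨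
        ¬ Even (∑ k ∈ S, (e ∩ phiZ (g k)).card)) :
    ∑ lam ∈ Finset.univ.filter
        (fun lam : {e // e ∈ M} → ZMod 2 × ZMod 2 × ZMod 2 =>
          ∑ k ∈ S, simOutput M (g k) (ι k) lam = 0),
      ((1 : ℝ) / 8) ^ M.card = 1 / 2 := by
  obtain ⟨e, he, hodd⟩ := hodd
  obtain ⟨t, ht⟩ : ∃ t : ZMod 2 × ZMod 2 × ZMod 2,
      ((∑ k ∈ S, (e ∩ phiX (g k)).card : ℕ) : ZMod 2) * t.1 +
      ((∑ k ∈ S, (e ∩ phiY (g k)).card : ℕ) : ZMod 2) * t.2.1 +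
      ((∑ k ∈ S, (e ∩ phiZ (g k)).card : ℕ) : ZMod 2) * t.2.2 = 1 := by
    simp only [Nat.not_even_iff_odd, ← ZMod.natCast_eq_one_iff_odd] at hodd
    rcases hodd with h | h | h
    · exact ⟨(1, 0, 0), by simp only [h]; ring⟩
    · exact ⟨(0, 1, 0), by simp only [h]; ring⟩
    · exact ⟨(0, 0, 1), by simp only [h]; ring⟩
  have hhalf := two_mul_card_filter_eq_zero_of_add_eq_add_one
    (fun lam : {e // e ∈ M} → ZMod 2 × ZMod 2 × ZMod 2 => ∑ k ∈ S, simOutput M (g k) (ι k) lam)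
    (Pi.single ⟨e, he⟩ t) fun lam => by
      simp only [simOutput_add_single, Finset.sum_add_distrib, ← Finset.sum_mul]
      rw [← ht]
      push_cast
      rfl
  have hcard_assignments :
      Fintype.card ({e // e ∈ M} → ZMod 2 × ZMod 2 × ZMod 2) = 8 ^ M.card := by
    simp [ZMod.card]
  rw [hcard_assignments] at hhalf
  have hhalf_real : (2 : ℝ) * (Finset.univ.filter
      fun lam : {e // e ∈ M} → ZMod 2 × ZMod 2 × ZMod 2 =>
        ∑ k ∈ S, simOutput M (g k) (ι k) lam = 0).card = 8 ^ M.card := by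
    exact_mod_cast hhalf
  rw [Finset.sum_const, nsmul_eq_mul, one_div_pow]
  field_simp
  linarith
end

section
/- Let p be a correlation that is network-local with respect to a finite source set E and assignment A : Fin N → Finset E, and let T be a set of parties whose read sets are pairwise disjoint (A i ∩ A i' = ∅ for distinct i, i' ∈ T). Then the marginal distribution of the outputs of the parties in T factorizes as the product of the individual marginal distributions: for all outputs (a_i)_{i∈T}, the probability that each party i ∈ T outputs a_i (summing p over all outputs of the other parties) equals the product over i ∈ T of the marginal probability that party i outputs a_i. (Independence of parties reading disjoint sources in a network-local model, used in the proof of Proposition 1.) -/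
/-- A pmf `p` on the joint outputs `∀ i, O i` of the parties is *network-local* with
respect to a finite source set `E` and an assignment `A : I → Finset E` (telling which
sources each party reads) if it arises from independent finite hidden variables
`Λ_e` with distributions `μ_e` on the sources, and local response pmfs `q_i` depending
only on the hidden variables of the sources that party `i` reads. -/
def IsNetworkLocal {E : Type} [Fintype E] [DecidableEq E] {I : Type} [Fintype I]
    (O : I → Type) [∀ i, Fintype (O i)]
    (A : I → Finset E) (p : ((i : I) → O i) → ℝ) : Prop :=
  ∃ (Λ : E → Type) (fΛ : ∀ e, Fintype (Λ e)),
    (∀ e, Nonempty (Λ e)) ∧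
    ∃ (μ : (e : E) → Λ e → ℝ)
      (q : (i : I) → ((e : {e // e ∈ A i}) → Λ e.1) → O i → ℝ),
      (∀ e l, 0 ≤ μ e l) ∧
      (∀ e, letI := fΛ e; ∑ l, μ e l = 1) ∧
      (∀ i lam a, 0 ≤ q i lam a) ∧
      (∀ i lam, ∑ a, q i lam a = 1) ∧
      (∀ a, p a =
        letI := fΛ
        ∑ lam : (e : E) → Λ e,
          (∏ e, μ e (lam e)) * ∏ i, q i (fun e => lam e.1) (a i))

/-- Summing a product of functions of the coordinates over all `a` that agree with `b` on `T`
leaves only the factors in `T`, provided that every function sums to one. -/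
theorem sum_prod_filter_eq_on {I : Type*} [Fintype I] [DecidableEq I] {O : I → Type*}
    [∀ i, Fintype (O i)] [∀ i, DecidableEq (O i)] (r : (i : I) → O i → ℝ)
    (hr : ∀ i, ∑ a, r i a = 1) (T : Finset I) (b : (i : I) → O i)
    [DecidablePred fun a : (i : I) → O i => ∀ i ∈ T, a i = b i] :
    ∑ a ∈ Finset.univ.filter (fun a : (i : I) → O i => ∀ i ∈ T, a i = b i), ∏ i, r i (a i) =
      ∏ i ∈ T, r i (b i) := by
  have hset : Finset.univ.filter (fun a : (i : I) → O i => ∀ i ∈ T, a i = b i) =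
      Fintype.piFinset (fun i => if i ∈ T then {b i} else Finset.univ) := by
    ext a
    simp only [Finset.mem_filter, Finset.mem_univ, true_and, Fintype.mem_piFinset]
    refine forall_congr' fun i => ?_
    by_cases hi : i ∈ T <;> simp [hi]
  rw [hset, ← Finset.prod_univ_sum, ← Finset.prod_subset (Finset.subset_univ T)]
  · exact Finset.prod_congr rfl fun i hi => by simp [hi]
  · intro i _ hi
    simpa [hi] using hr i

/-- Exchanging the coordinates in `S` between two points. -/
theorem involutive_piecewise_swap {E : Type*} [DecidableEq E] {Λ : E → Type*}
    (S : Finset E) :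
    Function.Involutive (fun z : ((e : E) → Λ e) × ((e : E) → Λ e) =>
      (S.piecewise z.1 z.2, S.piecewise z.2 z.1)) := by
  rintro ⟨x, y⟩
  ext e <;> by_cases he : e ∈ S <;> simp [he]

section ProductWeights

variable {E : Type*} [Fintype E] [DecidableEq E] {Λ : E → Type*} [∀ e, Fintype (Λ e)]
  {μ : (e : E) → Λ e → ℝ}

theorem sum_prod_weights_eq_one (hμ : ∀ e, ∑ l, μ e l = 1) :
    ∑ x : (e : E) → Λ e, ∏ e, μ e (x e) = 1 := by
  rw [← Fintype.piFinset_univ, ← Finset.prod_univ_sum]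
  simp [hμ]

/-- Under a product weight, functions of complementary sets of coordinates are uncorrelated. -/
theorem sum_weight_mul_of_dependsOn (hμ : ∀ e, ∑ l, μ e l = 1) (S : Finset E)
    {g h : ((e : E) → Λ e) → ℝ} (hg : DependsOn g (S : Set E))
    (hh : DependsOn h (S : Set E)ᶜ) :
    ∑ x : (e : E) → Λ e, (∏ e, μ e (x e)) * (g x * h x) =
      (∑ x : (e : E) → Λ e, (∏ e, μ e (x e)) * g x) *
        ∑ x : (e : E) → Λ e, (∏ e, μ e (x e)) * h x := by
  rw [← mul_one (∑ x : (e : E) → Λ e, _ * (g x * h x)), ← sum_prod_weights_eq_one hμ,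
    Fintype.sum_mul_sum, Fintype.sum_mul_sum, ← Fintype.sum_prod_type', ← Fintype.sum_prod_type']
  refine (Fintype.sum_equiv (involutive_piecewise_swap S).toPerm _ _ ?_).symm
  rintro ⟨x, y⟩
  have hw : (∏ e, μ e (S.piecewise x y e)) * ∏ e, μ e (S.piecewise y x e) =
      (∏ e, μ e (x e)) * ∏ e, μ e (y e) := by
    rw [← Finset.prod_mul_distrib, ← Finset.prod_mul_distrib]
    refine Finset.prod_congr rfl fun e _ => ?_
    by_cases he : e ∈ S <;> simp [he, mul_comm]
  have hgx : g (S.piecewise x y) = g x := hg fun e he => by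
    simp [Finset.mem_coe.1 he]
  have hhy : h (S.piecewise x y) = h y := hh fun e he => by
    simp [show e ∉ S from he]
  simp only [Function.Involutive.coe_toPerm, hgx, hhy]
  linear_combination (-(g x * h y)) * hw

/-- Under a product weight, functions of pairwise disjoint sets of coordinates are independent. -/
theorem sum_weight_mul_prod_of_dependsOn (hμ : ∀ e, ∑ l, μ e l = 1) {I : Type*}
    (A : I → Finset E) (f : I → ((e : E) → Λ e) → ℝ)
    (hf : ∀ i, DependsOn (f i) (A i : Set E)) (T : Finset I)
    (hdisj : ∀ i ∈ T, ∀ i' ∈ T, i ≠ i' → Disjoint (A i) (A i')) :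
    ∑ x : (e : E) → Λ e, (∏ e, μ e (x e)) * ∏ i ∈ T, f i x =
      ∏ i ∈ T, ∑ x : (e : E) → Λ e, (∏ e, μ e (x e)) * f i x := by
  classical
  induction T using Finset.induction_on with
  | empty => simpa using sum_prod_weights_eq_one hμ
  | insert j T hj ih =>
    have hrest : DependsOn (fun x => ∏ i ∈ T, f i x) (A j : Set E)ᶜ := fun x y hxy =>
      Finset.prod_congr rfl fun i hi => hf i fun e he => hxy e fun hej =>
        Finset.disjoint_left.1 (hdisj j (Finset.mem_insert_self j T) i
          (Finset.mem_insert_of_mem hi) (ne_of_mem_of_not_mem hi hj).symm) hej he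
    simp only [Finset.prod_insert hj]
    rw [sum_weight_mul_of_dependsOn hμ (A j) (hf j) hrest,
      ih fun i hi i' hi' => hdisj i (Finset.mem_insert_of_mem hi) i' (Finset.mem_insert_of_mem hi')]

end ProductWeights

/-- In a network-local model, parties whose read sets of sources are pairwise disjoint
have independent outputs: the joint marginal of the parties in `T` is the product of
their individual marginals. -/
theorem networkLocal_disjoint_parties_independent
    {E : Type} [Fintype E] [DecidableEq E] (N : ℕ)
    (O : Fin N → Type) [∀ i, Fintype (O i)] [∀ i, Nonempty (O i)] [∀ i, DecidableEq (O i)]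
    (A : Fin N → Finset E) (p : ((i : Fin N) → O i) → ℝ)
    (hp : IsNetworkLocal O A p)
    (T : Finset (Fin N))
    (hdisj : ∀ i ∈ T, ∀ i' ∈ T, i ≠ i' → Disjoint (A i) (A i')) :
    ∀ b : (i : Fin N) → O i,
      ∑ a ∈ Finset.univ.filter (fun a : (i : Fin N) → O i => ∀ i ∈ T, a i = b i), p a =
      ∏ i ∈ T, ∑ a ∈ Finset.univ.filter (fun a : (i : Fin N) → O i => a i = b i), p a := by
  intro b
  obtain ⟨Λ, fΛ, -, μ, q, -, hμ, -, hq, hp⟩ := hp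
  have hmarg : ∀ S : Finset (Fin N),
      ∑ a ∈ Finset.univ.filter (fun a : (i : Fin N) → O i => ∀ i ∈ S, a i = b i), p a =
        ∑ x : (e : E) → Λ e, (∏ e, μ e (x e)) * ∏ i ∈ S, q i (fun e => x e.1) (b i) := by
    intro S
    simp only [hp]
    rw [Finset.sum_comm]
    refine Finset.sum_congr rfl fun x _ => ?_
    rw [← Finset.mul_sum, sum_prod_filter_eq_on (fun i => q i fun e => x e.1) (fun i => hq i _)]
  rw [hmarg T, sum_weight_mul_prod_of_dependsOn hμ A (fun i x => q i (fun e => x e.1) (b i))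
    (fun i x y hxy => congrArg (fun l => q i l (b i)) (funext fun e => hxy e.1 e.2)) T hdisj]
  refine Finset.prod_congr rfl fun i _ => ?_
  simpa using (hmarg {i}).symm
end

section
/- Consider N + r parties indexed by Fin N ⊕ Fin r, with finite nonempty output types O_i for the first N parties and C_j for the last r parties, where each C_j has a distinguished element 0_j. Let E' be a finite source set and Â : Fin N ⊕ Fin r → Finset E' an assignment such that every source e ∈ E' belongs to Â(inr j) for exactly one j < r (in particular the sets Â(inr j) are pairwise disjoint and cover E'). Suppose the joint correlation p̂ on (∏_{i<N} O_i) × (∏_{j<r} C_j) is network-local with respect to (E', Â), and that the event c = (0_0, …, 0_{r−1}) has positive probability under the marginal of p̂. Then the conditional correlation p(a) := p̂(a, 0⃗) / p̂(c = 0⃗) on ∏_{i<N} O_i is network-local with respect to the source set Fin r and the assignment A : Fin N → Finset (Fin r) given by A i := { j | Â(inl i) ∩ Â(inr j) ≠ ∅ }. (Classical post-selection direction of Proposition 1: conditioning a network-local model on the auxiliary parties' outcomes yields a network-local model on the merged hypergraph network, in which each merged source j is shared among exactly the parties connected to the auxiliary party C_j.) -/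
instance sumElimFintype {α β : Type} {O : α → Type} {C : β → Type}
    [∀ i, Fintype (O i)] [∀ j, Fintype (C j)] (i : α ⊕ β) :
    Fintype (Sum.elim O C i) :=
  match i with
  | Sum.inl i => inferInstanceAs (Fintype (O i))
  | Sum.inr j => inferInstanceAs (Fintype (C j))

/-- Combine an output tuple of the first `N` parties with an output tuple of the last
`r` parties into a joint output tuple indexed by `Fin N ⊕ Fin r`. -/
def glue {N r : ℕ} {O : Fin N → Type} {C : Fin r → Type}
    (a : (i : Fin N) → O i) (c : (j : Fin r) → C j) :
    (i : Fin N ⊕ Fin r) → Sum.elim O C i :=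
  fun i => match i with
  | Sum.inl i => a i
  | Sum.inr j => c j

/-- Regrouping the coordinates of a tuple indexed by `E` along a partition `S` of `E`
into blocks, where `f e` is the unique block containing `e`. -/
def piPartitionEquiv {E J : Type} (S : J → Finset E) (Λ : E → Type) (f : E → J)
    (hf : ∀ e, e ∈ S (f e)) (huniq : ∀ e j, e ∈ S j → j = f e) :
    ((e : E) → Λ e) ≃ ((j : J) → (e : {e // e ∈ S j}) → Λ e.1) where
  toFun lam := fun _ e => lam e.1
  invFun lam := fun e => lam (f e) ⟨e, hf e⟩
  left_inv _ := rfl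
  right_inv lam := by
    funext j ⟨e, he⟩
    obtain rfl := huniq e j he
    rfl

theorem prod_prod_partition {E J : Type} [Fintype E] [Fintype J] (S : J → Finset E)
    (hpart : ∀ e, ∃! j, e ∈ S j) (g : E → ℝ) :
    ∏ j, ∏ e : {e // e ∈ S j}, g e.1 = ∏ e, g e := by
  rw [← Fintype.prod_sigma']
  refine Fintype.prod_bijective
    (fun x : (j : J) × {e // e ∈ S j} => x.2.1) ⟨?_, fun e => ?_⟩ _ _ fun _ => rfl
  · rintro ⟨j, e, he⟩ ⟨k, e', he'⟩ (rfl : e = e')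
    obtain rfl := (hpart e).unique he he'
    rfl
  · obtain ⟨j, hj, -⟩ := hpart e
    exact ⟨⟨j, e, hj⟩, rfl⟩

theorem sum_pi_prod_eq_prod_sum {ι : Type} [Fintype ι] [DecidableEq ι] {κ : ι → Type}
    [∀ i, Fintype (κ i)] (g : (i : ι) → κ i → ℝ) :
    ∑ x : (i : ι) → κ i, ∏ i, g i (x i) = ∏ i, ∑ k, g i k := by
  rw [Finset.prod_univ_sum, Fintype.piFinset_univ]

/-- Classical post-selection direction of Proposition 1: if the joint correlation
`p̂` of `N` real parties and `r` auxiliary parties is network-local with respect to a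
source set `E'` in which each source is read by exactly one auxiliary party, and the
event that all auxiliary parties output their distinguished value `0` has positive
probability, then the conditional correlation of the `N` real parties is network-local
with respect to the merged source set `Fin r`, where each merged source `j` is read by
exactly the real parties sharing a source with the auxiliary party `j`. -/
theorem networkLocal_of_postselection (N r : ℕ)
    (O : Fin N → Type) [∀ i, Fintype (O i)] [∀ i, Nonempty (O i)] [∀ i, DecidableEq (O i)]
    (C : Fin r → Type) [∀ j, Fintype (C j)] [∀ j, Nonempty (C j)] [∀ j, DecidableEq (C j)]
    (c0 : (j : Fin r) → C j)
    {E' : Type} [Fintype E'] [DecidableEq E']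
    (Ahat : Fin N ⊕ Fin r → Finset E')
    (hpart : ∀ e : E', ∃! j : Fin r, e ∈ Ahat (Sum.inr j))
    (phat : ((i : Fin N ⊕ Fin r) → Sum.elim O C i) → ℝ)
    (hlocal : IsNetworkLocal (Sum.elim O C) Ahat phat)
    (Z : ℝ) (hZ : Z = ∑ a : (i : Fin N) → O i, phat (glue a c0)) (hZpos : 0 < Z) :
    IsNetworkLocal (E := Fin r) O
      (fun i => Finset.univ.filter
        (fun j : Fin r => (Ahat (Sum.inl i) ∩ Ahat (Sum.inr j)).Nonempty))
      (fun a => phat (glue a c0) / Z) := by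
  obtain ⟨Λ, fΛ, hne, μ, q, hμ, hμsum, hq, hqsum, hp⟩ := hlocal
  let := fΛ
  choose f hf huniq using hpart
  have hpart : ∀ e : E', ∃! j : Fin r, e ∈ Ahat (Sum.inr j) :=
    fun e => ⟨f e, hf e, huniq e⟩
  let Φ := piPartitionEquiv (fun j => Ahat (Sum.inr j)) Λ f hf huniq
  -- the unnormalized weights of the merged sources
  let w (j : Fin r) (l : (e : {e // e ∈ Ahat (Sum.inr j)}) → Λ e.1) : ℝ :=
    (∏ e, μ e.1 (l e)) * q (Sum.inr j) l (c0 j)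
  let q' (i : Fin N)
      (l : (j : {j // j ∈ Finset.univ.filter
        (fun j : Fin r => (Ahat (Sum.inl i) ∩ Ahat (Sum.inr j)).Nonempty)}) →
        (e : {e // e ∈ Ahat (Sum.inr j.1)}) → Λ e.1) (x : O i) : ℝ :=
    q (Sum.inl i) (fun e => l ⟨f e.1, Finset.mem_filter.2 ⟨Finset.mem_univ _,
      ⟨e.1, Finset.mem_inter.2 ⟨e.2, hf e.1⟩⟩⟩⟩ ⟨e.1, hf e.1⟩) x
  have hw : ∀ j l, 0 ≤ w j l := fun j l =>
    mul_nonneg (Finset.prod_nonneg fun e _ => hμ _ _) (hq _ _ _)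
  have hq'sum : ∀ i l, ∑ x, q' i l x = 1 := fun i l => hqsum (Sum.inl i) _
  have hphat : ∀ a, phat (glue a c0) =
      ∑ l : (j : Fin r) → (e : {e // e ∈ Ahat (Sum.inr j)}) → Λ e.1,
        (∏ j, w j (l j)) * ∏ i, q' i (fun j => l j.1) (a i) := by
    intro a
    rw [hp, ← Equiv.sum_comp Φ]
    refine Finset.sum_congr rfl fun lam _ => ?_
    have hprod : ∏ j, w j (Φ lam j) =
        (∏ e, μ e (lam e)) * ∏ j, q (Sum.inr j) (fun e => lam e.1) (c0 j) := by
      rw [← prod_prod_partition _ hpart, ← Finset.prod_mul_distrib]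
      rfl
    rw [hprod, Fintype.prod_sum_type, mul_comm (∏ i, q (Sum.inl i) _ _), ← mul_assoc]
    rfl
  have hZprod : Z = ∏ j, ∑ l, w j l := by
    rw [hZ, ← sum_pi_prod_eq_prod_sum]
    simp_rw [hphat]
    rw [Finset.sum_comm]
    refine Finset.sum_congr rfl fun l _ => ?_
    rw [← Finset.mul_sum, sum_pi_prod_eq_prod_sum]
    simp [hq'sum]
  have hZne : ∀ j, ∑ l, w j l ≠ 0 := fun j =>
    Finset.prod_ne_zero_iff.1 (hZprod ▸ hZpos.ne') j (Finset.mem_univ j)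
  refine ⟨fun j => (e : {e // e ∈ Ahat (Sum.inr j)}) → Λ e.1, fun j => inferInstance,
    fun j => inferInstance, fun j l => w j l / ∑ l', w j l', q', fun j l =>
      div_nonneg (hw j l) (Finset.sum_nonneg fun _ _ => hw j _), fun j => ?_,
    fun i l x => hq _ _ _, hq'sum, fun a => ?_⟩
  · rw [← Finset.sum_div, div_self (hZne j)]
  · simp only [Finset.prod_div_distrib]
    rw [hphat, hZprod, Finset.sum_div]
    refine Finset.sum_congr rfl fun l _ => ?_
    ring
end

section
/- Let M be a perfect matching on Fin n and let Φ_M : (Fin n → ZMod 2) → ℂ be the (unnormalized) product of Bell pairs along M, defined by Φ_M(b) = 1 if b is constant on every edge of M and Φ_M(b) = 0 otherwise. For x, z : Fin n → ZMod 2, let P(x,z) be the Hermitian Pauli string operator on the complex function space (Fin n → ZMod 2) → ℂ defined by (P(x,z) ψ)(b) := i^{|{i | x i = 1 ∧ z i = 1}|} · (−1)^{⟨z, b + x⟩} · ψ(b + x), where ⟨z, c⟩ := |{i | z i = 1 ∧ c i = 1}| and the power of −1 is taken with this natural-number exponent. Then the inner product ⟨Φ_M, P(x,z) Φ_M⟩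 := ∑_b conj(Φ_M(b)) · (P(x,z)Φ_M)(b) equals 0 unless both x and z are constant on every edge of M, and in that case it equals (−1)^{|{e ∈ M | x i = 1 and z i = 1 for all i ∈ e}|} · 2^{|M|}. (Expectation formula for Pauli string observables on a product of Bell pairs, the quantum input to the correctness of the classical model in Theorem 1: the expectation is ±1 exactly when ±P(x,z) stabilizes Φ_M, with sign determined by the number of Y⊗Y edges, and 0 otherwise.) -/
/-- The (unnormalized) product of Bell pairs along a perfect matching `M`:
the amplitude of a basis string `b` is `1` if `b` is constant on every edge of `M`
and `0` otherwise. -/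
def bellState {n : ℕ} (M : Finset (Finset (Fin n))) : (Fin n → ZMod 2) → ℂ :=
  fun b => if ∀ e ∈ M, ∀ i ∈ e, ∀ j ∈ e, b i = b j then 1 else 0

/-- The Hermitian `n`-qubit Pauli string operator with X-part `x` and Z-part `z`,
acting on complex functions on computational basis strings:
`(P(x,z) ψ)(b) = i^{|φ_Y|} · (−1)^{⟨z, b + x⟩} · ψ(b + x)`. -/
def pauliOp {n : ℕ} (x z : Fin n → ZMod 2) (ψ : (Fin n → ZMod 2) → ℂ) :
    (Fin n → ZMod 2) → ℂ :=
  fun b =>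
    Complex.I ^ (Finset.univ.filter (fun i : Fin n => x i = 1 ∧ z i = 1)).card *
    (-1 : ℂ) ^ (Finset.univ.filter (fun i : Fin n => z i = 1 ∧ (b + x) i = 1)).card *
    ψ (b + x)

/-- The sign `(−1)^{⟨z, c⟩}` is a character in `c`. -/
theorem neg_one_pow_card_pairing_add {n : ℕ} (z c t : Fin n → ZMod 2) :
    (-1 : ℂ) ^ (Finset.univ.filter (fun i : Fin n => z i = 1 ∧ (c + t) i = 1)).card =
      (-1 : ℂ) ^ (Finset.univ.filter (fun i : Fin n => z i = 1 ∧ c i = 1)).card *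
        (-1 : ℂ) ^ (Finset.univ.filter (fun i : Fin n => z i = 1 ∧ t i = 1)).card := by
  have key : ∀ a b : ZMod 2, (if a + b = 1 then (-1 : ℂ) else 1) =
      (if a = 1 then (-1 : ℂ) else 1) * (if b = 1 then (-1 : ℂ) else 1) := by
    have h01 : ∀ a : ZMod 2, a = 0 ∨ a = 1 := by decide
    have h11 : (1 : ZMod 2) + 1 = 0 := by decide
    intro a b
    rcases h01 a with rfl | rfl <;> rcases h01 b with rfl | rfl <;> simp [h11]
  simp only [← Finset.prod_const, Finset.prod_filter]
  rw [← Finset.prod_mul_distrib]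
  refine Finset.prod_congr rfl fun i _ => ?_
  by_cases hz : z i = 1
  · simpa [hz] using key (c i) (t i)
  · simp [hz]

/-- A predicate constant on the edges of a perfect matching holds at twice as many vertices
as edges. -/
theorem card_filter_eq_two_mul_of_matching {n : ℕ} {M : Finset (Finset (Fin n))}
    (hcard : ∀ e ∈ M, e.card = 2) (hcover : ∀ i : Fin n, ∃! e, e ∈ M ∧ i ∈ e)
    (p : Fin n → Prop) [DecidablePred p]
    (hp : ∀ e ∈ M, ∀ i ∈ e, ∀ j ∈ e, p i → p j) :
    (Finset.univ.filter p).card = 2 * (M.filter (fun e => ∀ i ∈ e, p i)).card := by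
  have hU : Finset.univ.filter p = (M.filter (fun e => ∀ i ∈ e, p i)).biUnion id := by
    ext i
    simp only [Finset.mem_filter, Finset.mem_univ, true_and, Finset.mem_biUnion, id]
    constructor
    · intro hi
      obtain ⟨e, ⟨he, hie⟩, -⟩ := hcover i
      exact ⟨e, ⟨he, fun j hj => hp e he i hie j hj hi⟩, hie⟩
    · rintro ⟨e, ⟨-, h⟩, hie⟩
      exact h i hie
  rw [hU, Finset.card_biUnion, Finset.sum_congr rfl, Finset.sum_const, smul_eq_mul, mul_comm]
  · intro e he
    exact hcard e (Finset.mem_filter.mp he).1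
  · intro e he f hf hne
    refine Finset.disjoint_left.mpr fun i hie hif => hne ?_
    exact (hcover i).unique ⟨(Finset.mem_filter.mp he).1, hie⟩ ⟨(Finset.mem_filter.mp hf).1, hif⟩

/-- There are `2 ^ |M|` bit strings constant on the edges of a perfect matching `M`. -/
theorem card_edgewise_constant {n : ℕ} {M : Finset (Finset (Fin n))}
    (hcard : ∀ e ∈ M, e.card = 2) (hcover : ∀ i : Fin n, ∃! e, e ∈ M ∧ i ∈ e) :
    (Finset.univ.filter (fun b : Fin n → ZMod 2 =>
      ∀ e ∈ M, ∀ i ∈ e, ∀ j ∈ e, b i = b j)).card = 2 ^ M.card := by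
  choose f hf using fun i => (hcover i).exists
  have hfe : ∀ e ∈ M, ∀ i ∈ e, f i = e := fun e he i hi =>
    (hcover i).unique (hf i) ⟨he, hi⟩
  have hne : ∀ e ∈ M, ∃ i, i ∈ e := fun e he =>
    Finset.card_pos.mp (by rw [hcard e he]; norm_num)
  let g : (M → ZMod 2) → (Fin n → ZMod 2) := fun c i => c ⟨f i, (hf i).1⟩
  have hg : Function.Injective g := by
    intro c d h
    ext ⟨e, he⟩ : 1
    obtain ⟨i, hi⟩ := hne e he
    simpa [g, hfe e he i hi] using congrFun h i
  have hU : (Finset.univ.filter (fun b : Fin n → ZMod 2 =>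
      ∀ e ∈ M, ∀ i ∈ e, ∀ j ∈ e, b i = b j)) = Finset.univ.image g := by
    ext b
    simp only [Finset.mem_filter, Finset.mem_univ, true_and, Finset.mem_image]
    constructor
    · intro hb
      refine ⟨fun e => b (hne e.1 e.2).choose, funext fun i => ?_⟩
      exact hb _ (hf i).1 _ (hne _ (hf i).1).choose_spec _ (hf i).2
    · rintro ⟨c, rfl⟩ e he i hi j hj
      simp only [g, hfe e he i hi, hfe e he j hj]
  rw [hU, Finset.card_image_of_injective _ hg]
  simp [ZMod.card]

/-- A Bell product is invariant under translation by an edgewise constant bit string. -/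
theorem bellState_add {n : ℕ} {M : Finset (Finset (Fin n))} {t : Fin n → ZMod 2}
    (ht : ∀ e ∈ M, ∀ i ∈ e, ∀ j ∈ e, t i = t j) (b : Fin n → ZMod 2) :
    bellState M (b + t) = bellState M b := by
  unfold bellState
  refine if_congr ?_ rfl rfl
  refine forall₂_congr fun e he => forall₂_congr fun i hi => forall₂_congr fun j hj => ?_
  simp [ht e he i hi j hj]

/-- If the X-part is not edgewise constant, the supports of a Bell product and its image under
the Pauli string are disjoint. -/
theorem conj_bellState_mul_pauliOp_eq_zero {n : ℕ} {M : Finset (Finset (Fin n))}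
    {x : Fin n → ZMod 2} (hx : ¬ ∀ e ∈ M, ∀ i ∈ e, ∀ j ∈ e, x i = x j)
    (z b : Fin n → ZMod 2) :
    (starRingEnd ℂ) (bellState M b) * pauliOp x z (bellState M) b = 0 := by
  by_cases hb : ∀ e ∈ M, ∀ i ∈ e, ∀ j ∈ e, b i = b j
  · have h : bellState M (b + x) = 0 := by
      refine if_neg fun h => hx fun e he i hi j hj => ?_
      simpa [hb e he i hi j hj] using h e he i hi j hj
    simp [pauliOp, h]
  · have h : bellState M b = 0 := if_neg hb
    simp [h]

/-- If the Z-part is not edgewise constant, flipping both bits of an edge shows that the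
expectation vanishes. -/
theorem sum_conj_bellState_mul_pauliOp_eq_zero {n : ℕ} {M : Finset (Finset (Fin n))}
    (hcard : ∀ e ∈ M, e.card = 2) (hcover : ∀ i : Fin n, ∃! e, e ∈ M ∧ i ∈ e)
    (x : Fin n → ZMod 2) {z : Fin n → ZMod 2}
    (hz : ¬ ∀ e ∈ M, ∀ i ∈ e, ∀ j ∈ e, z i = z j) :
    ∑ b : Fin n → ZMod 2, (starRingEnd ℂ) (bellState M b) * pauliOp x z (bellState M) b = 0 := by
  obtain ⟨e, he, k, hk, hzk, hk_unique⟩ :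
      ∃ e ∈ M, ∃ k ∈ e, z k = 1 ∧ ∀ l ∈ e, z l = 1 → l = k := by
    push Not at hz
    obtain ⟨e, he, i, hi, j, hj, hij⟩ := hz
    have hne : i ≠ j := fun h => hij (congrArg z h)
    have hpair : e = {i, j} := by
      refine (Finset.eq_of_subset_of_card_le (by simp [Finset.insert_subset_iff, hi, hj]) ?_).symm
      rw [hcard e he, Finset.card_pair hne]
    have h2 : ∀ a b : ZMod 2, a ≠ b → (a = 1 ∧ b ≠ 1) ∨ (b = 1 ∧ a ≠ 1) := by decide
    rcases h2 _ _ hij with ⟨h1, h0⟩ | ⟨h1, h0⟩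
    · exact ⟨e, he, i, hi, h1, by rw [hpair]; simp [h0]⟩
    · exact ⟨e, he, j, hj, h1, by rw [hpair]; simp [h0]⟩
  let t : Fin n → ZMod 2 := fun i => if i ∈ e then 1 else 0
  have ht : ∀ d ∈ M, ∀ i ∈ d, ∀ j ∈ d, t i = t j := by
    intro d hd i hi j hj
    have hmem : ∀ l ∈ d, l ∈ e ↔ d = e := fun l hl =>
      ⟨fun hle => (hcover l).unique ⟨hd, hl⟩ ⟨he, hle⟩, fun h => h ▸ hl⟩
    simp only [t, hmem i hi, hmem j hj]
  have hsign : (Finset.univ.filter (fun i : Fin n => z i = 1 ∧ t i = 1)).card = 1 := by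
    refine Finset.card_eq_one.mpr ⟨k, ?_⟩
    ext l
    simp only [Finset.mem_filter, Finset.mem_univ, true_and, Finset.mem_singleton]
    constructor
    · rintro ⟨hl, hlt⟩
      refine hk_unique l ?_ hl
      by_contra h
      simp [t, h] at hlt
    · rintro rfl
      exact ⟨hzk, by simp [t, hk]⟩
  rw [← self_eq_neg, ← Finset.sum_neg_distrib]
  refine (Equiv.sum_comp (Equiv.addRight t) _).symm.trans (Finset.sum_congr rfl fun b _ => ?_)
  have hflip : pauliOp x z (bellState M) (b + t) = -pauliOp x z (bellState M) b := by
    unfold pauliOp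
    simp only [add_right_comm b t x]
    rw [bellState_add ht, neg_one_pow_card_pairing_add z (b + x) t, hsign]
    ring
  rw [Equiv.coe_addRight, hflip, bellState_add ht, mul_neg]

/-- If both parts are edgewise constant, each basis string contributes the sign given by the
number of `Y ⊗ Y` edges, or zero. -/
theorem conj_bellState_mul_pauliOp_of_constant {n : ℕ} {M : Finset (Finset (Fin n))}
    (hcard : ∀ e ∈ M, e.card = 2) (hcover : ∀ i : Fin n, ∃! e, e ∈ M ∧ i ∈ e)
    {x z : Fin n → ZMod 2} (hx : ∀ e ∈ M, ∀ i ∈ e, ∀ j ∈ e, x i = x j)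
    (hz : ∀ e ∈ M, ∀ i ∈ e, ∀ j ∈ e, z i = z j) (b : Fin n → ZMod 2) :
    (starRingEnd ℂ) (bellState M b) * pauliOp x z (bellState M) b =
      (-1 : ℂ) ^ (M.filter (fun e => ∀ i ∈ e, x i = 1 ∧ z i = 1)).card *
        if ∀ e ∈ M, ∀ i ∈ e, ∀ j ∈ e, b i = b j then 1 else 0 := by
  unfold pauliOp
  rw [bellState_add hx]
  by_cases hb : ∀ e ∈ M, ∀ i ∈ e, ∀ j ∈ e, b i = b j
  · have h : bellState M b = 1 := if_pos hb
    rw [h, if_pos hb,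
      card_filter_eq_two_mul_of_matching hcard hcover (fun i => x i = 1 ∧ z i = 1)
        (fun e he i hi j hj h => by rwa [hx e he j hj i hi, hz e he j hj i hi]),
      card_filter_eq_two_mul_of_matching hcard hcover (fun i => z i = 1 ∧ (b + x) i = 1)
        (fun e he i hi j hj h => by
          rwa [Pi.add_apply, hx e he j hj i hi, hz e he j hj i hi, hb e he j hj i hi]),
      pow_mul, pow_mul, Complex.I_sq]
    simp
  · have h : bellState M b = 0 := if_neg hb
    rw [h, if_neg hb]
    simp

/-- Expectation of a Hermitian Pauli string on a product of Bell pairs along a perfect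
matching `M`: the inner product `⟨Φ_M, P(x,z) Φ_M⟩` vanishes unless both `x` and `z`
are constant on every edge of `M`, in which case it equals
`(−1)^{#(Y⊗Y edges)} · 2^{|M|}`. -/
theorem bellState_pauli_expectation (n : ℕ) (M : Finset (Finset (Fin n)))
    (hcard : ∀ e ∈ M, e.card = 2)
    (hcover : ∀ i : Fin n, ∃! e, e ∈ M ∧ i ∈ e)
    (x z : Fin n → ZMod 2) :
    (¬ ((∀ e ∈ M, ∀ i ∈ e, ∀ j ∈ e, x i = x j) ∧ (∀ e ∈ M, ∀ i ∈ e, ∀ j ∈ e, z i = z j)) →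
      ∑ b : Fin n → ZMod 2, (starRingEnd ℂ) (bellState M b) * pauliOp x z (bellState M) b
        = 0) ∧
    (((∀ e ∈ M, ∀ i ∈ e, ∀ j ∈ e, x i = x j) ∧ (∀ e ∈ M, ∀ i ∈ e, ∀ j ∈ e, z i = z j)) →
      ∑ b : Fin n → ZMod 2, (starRingEnd ℂ) (bellState M b) * pauliOp x z (bellState M) b
        = (-1 : ℂ) ^ (M.filter (fun e => ∀ i ∈ e, x i = 1 ∧ z i = 1)).card
            * 2 ^ M.card) := by
  refine ⟨fun h => ?_, fun ⟨hx, hz⟩ => ?_⟩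
  · by_cases hx : ∀ e ∈ M, ∀ i ∈ e, ∀ j ∈ e, x i = x j
    · exact sum_conj_bellState_mul_pauliOp_eq_zero hcard hcover x fun hz => h ⟨hx, hz⟩
    · exact Finset.sum_eq_zero fun b _ => conj_bellState_mul_pauliOp_eq_zero hx z b
  · rw [Finset.sum_congr rfl fun b _ =>
      conj_bellState_mul_pauliOp_of_constant hcard hcover hx hz b, ← Finset.mul_sum,
      Finset.sum_boole, card_edgewise_constant hcard hcover]
    push_cast
    rfl
end
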